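/- arXiv:2210.14016 — 2 statements merged into one kernel-verified Lean document; each statement's English description precedes it below -/
import Mathlib

section
/- Invariance of SEP crossover and standard crossover to parent permutation: fix n × n matrices Opt, A₁, A₂ with entries in a type with decidable equality, a permutation σ of Fin n, and a permutation π_b of Fin n, and set π_a = π_b ∘ σ. When the choice mask c is drawn uniformly at random from all functions Fin n → Fin n → Bool, the distribution of GED(Opt, rec c (A₁^σ) (A₂^{π_a})) equals the distribution of GED(Opt, rec c A₁ (A₂^{π_b})). Moreover, when (c, π) is drawn uniformly from all pairs of a choice mask and a permutation of Fin n, the distribution of GED(Opt, rec c (A₁^σ) (A₂^π)) equals the distribution of GED(Opt, rec c A₁ (A₂^π)). -/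
open Finset

/-- Conjugation of a matrix `A` by a permutation `σ`: `(A^σ) i j = A (σ i) (σ j)`. -/
def conj {α : Type*} {n : ℕ} (σ : Equiv.Perm (Fin n)) (A : Fin n → Fin n → α) :
    Fin n → Fin n → α :=
  fun i j => A (σ i) (σ j)

/-- `dd A B`: the number of pairs `(i,j)` with `A i j ≠ B i j`. -/
def dd {α : Type*} [DecidableEq α] {n : ℕ} (A B : Fin n → Fin n → α) : ℕ :=
  (Finset.univ.filter fun p : Fin n × Fin n => A p.1 p.2 ≠ B p.1 p.2).card

/-- `GED A B`: the minimum of `dd A (B^π)` over all permutations `π`. -/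
def GED {α : Type*} [DecidableEq α] {n : ℕ} (A B : Fin n → Fin n → α) : ℕ :=
  Finset.univ.inf' Finset.univ_nonempty fun π : Equiv.Perm (Fin n) => dd A (conj π B)

/-- Elementwise recombination (crossover): the `(i,j)` entry of `recomb c A B`
is `A i j` if `c i j = true` and `B i j` otherwise. -/
def recomb {α : Type*} {n : ℕ} (c : Fin n → Fin n → Bool) (A B : Fin n → Fin n → α) :
    Fin n → Fin n → α :=
  fun i j => if c i j then A i j else B i j

theorem GED_conj {α : Type*} [DecidableEq α] {n : ℕ} (σ : Equiv.Perm (Fin n))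
    (A B : Fin n → Fin n → α) : GED A (conj σ B) = GED A B := by
  unfold GED
  apply le_antisymm
  · refine Finset.le_inf' _ _ fun π _ => ?_
    refine (Finset.inf'_le (fun π : Equiv.Perm (Fin n) => dd A (conj π (conj σ B)))
      (Finset.mem_univ (π.trans σ.symm))).trans (le_of_eq ?_)
    have h : conj (π.trans σ.symm) (conj σ B) = conj π B := by
      funext i j
      simp [conj]
    simp only [h]
  · refine Finset.le_inf' _ _ fun π _ => ?_
    exact Finset.inf'_le (fun π : Equiv.Perm (Fin n) => dd A (conj π B))
      (Finset.mem_univ (π.trans σ))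

theorem map_uniform_congr {β γ : Type*} [Fintype β] [Nonempty β] (e : β ≃ β) (f g : β → γ)
    (h : ∀ b, f (e b) = g b) :
    PMF.map f (PMF.uniformOfFintype β) = PMF.map g (PMF.uniformOfFintype β) := by
  classical
  ext y
  simp only [PMF.map_apply, PMF.uniformOfFintype_apply]
  rw [← e.tsum_eq]
  simp only [h]

/-- Conjugation of masks, as an equivalence. -/
def conjEquiv {n : ℕ} (σ : Equiv.Perm (Fin n)) :
    (Fin n → Fin n → Bool) ≃ (Fin n → Fin n → Bool) where
  toFun := conj σ
  invFun := conj σ.symm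
  left_inv c := by funext i j; simp [conj]
  right_inv c := by funext i j; simp [conj]

/-- Invariance of the SEP crossover and of the standard crossover to a
permutation of the first parent:  with `π_a = π_b ∘ σ` (written `σ.trans π_b`),
the distribution of `GED(Opt, rec c (A₁^σ) (A₂^{π_a}))` under a uniformly random
choice mask `c` equals the distribution of `GED(Opt, rec c A₁ (A₂^{π_b}))`, and
the distribution of `GED(Opt, rec c (A₁^σ) (A₂^π))` under a uniformly random
pair `(c, π)` equals the distribution of `GED(Opt, rec c A₁ (A₂^π))`. -/
theorem crossover_invariance_to_parent_permutation {α : Type*} [DecidableEq α] {n : ℕ}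
    (Opt A₁ A₂ : Fin n → Fin n → α) (σ π_b : Equiv.Perm (Fin n)) :
    (PMF.map (fun c : Fin n → Fin n → Bool =>
        GED Opt (recomb c (conj σ A₁) (conj (σ.trans π_b) A₂)))
      (PMF.uniformOfFintype (Fin n → Fin n → Bool)) =
      PMF.map (fun c : Fin n → Fin n → Bool => GED Opt (recomb c A₁ (conj π_b A₂)))
        (PMF.uniformOfFintype (Fin n → Fin n → Bool))) ∧
    (PMF.map (fun q : (Fin n → Fin n → Bool) × Equiv.Perm (Fin n) =>
        GED Opt (recomb q.1 (conj σ A₁) (conj q.2 A₂)))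
      (PMF.uniformOfFintype ((Fin n → Fin n → Bool) × Equiv.Perm (Fin n))) =
      PMF.map (fun q : (Fin n → Fin n → Bool) × Equiv.Perm (Fin n) =>
          GED Opt (recomb q.1 A₁ (conj q.2 A₂)))
        (PMF.uniformOfFintype ((Fin n → Fin n → Bool) × Equiv.Perm (Fin n)))) := by
  constructor
  · refine map_uniform_congr (conjEquiv σ) _ _ fun c => ?_
    exact GED_conj σ Opt (recomb c A₁ (conj π_b A₂))
  · refine map_uniform_congr
      ((conjEquiv σ).prodCongr (Equiv.mulRight σ)) _ _ fun q => ?_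
    exact GED_conj σ Opt (recomb q.1 A₁ (conj q.2 A₂))
end

section
/- Lower bound for common parts of an optimum and two parents: for any n × n matrices Opt, A₁, A₂ with entries in a type with decidable equality, there exist permutations π₁ and π₂ of Fin n such that d(Opt, A₁^{π₁}) = GED(Opt, A₁), d(A₁^{π₁}, A₂^{π₂}) = GED(A₁, A₂), and s(Opt, A₁^{π₁}, A₂^{π₂}) ≥ n² − GED(Opt, A₁) − GED(A₁, A₂) (in particular the left side is also ≥ 0, so it is ≥ max of that quantity with 0), with the analogous bounds s_v ≥ n − d_v(Opt, A₁^{π₁}) − d_v(A₁^{π₁}, A₂^{π₂}) and s_e ≥ n(n−1) − d_e(Opt, A₁^{π₁}) − d_e(A₁^{π₁}, A₂^{π₂}) for the diagonal and off-diagonal agreement counts. -/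
open Finset

/-- `dv A B`: the number of diagonal indices `i` with `A i i ≠ B i i`. -/
def dv {α : Type*} [DecidableEq α] {n : ℕ} (A B : Fin n → Fin n → α) : ℕ :=
  (Finset.univ.filter fun i : Fin n => A i i ≠ B i i).card

/-- `de A B`: the number of off-diagonal pairs `(i,j)` with `i ≠ j` and `A i j ≠ B i j`. -/
def de {α : Type*} [DecidableEq α] {n : ℕ} (A B : Fin n → Fin n → α) : ℕ :=
  (Finset.univ.filter fun p : Fin n × Fin n => p.1 ≠ p.2 ∧ A p.1 p.2 ≠ B p.1 p.2).card

/-- `s₃ A B C`: the number of pairs `(i,j)` with `A i j = B i j = C i j`. -/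
def s₃ {α : Type*} [DecidableEq α] {n : ℕ} (A B C : Fin n → Fin n → α) : ℕ :=
  (Finset.univ.filter fun p : Fin n × Fin n =>
    A p.1 p.2 = B p.1 p.2 ∧ B p.1 p.2 = C p.1 p.2).card

/-- `sv₃ A B C`: the number of diagonal indices `i` with `A i i = B i i = C i i`. -/
def sv₃ {α : Type*} [DecidableEq α] {n : ℕ} (A B C : Fin n → Fin n → α) : ℕ :=
  (Finset.univ.filter fun i : Fin n => A i i = B i i ∧ B i i = C i i).card

/-- `se₃ A B C`: the number of off-diagonal pairs `(i,j)` with `i ≠ j` and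
`A i j = B i j = C i j`. -/
def se₃ {α : Type*} [DecidableEq α] {n : ℕ} (A B C : Fin n → Fin n → α) : ℕ :=
  (Finset.univ.filter fun p : Fin n × Fin n =>
    p.1 ≠ p.2 ∧ A p.1 p.2 = B p.1 p.2 ∧ B p.1 p.2 = C p.1 p.2).card

theorem card_aux {β : Type*} [DecidableEq β] (S T U V : Finset β)
    (h : ∀ x ∈ S, x ∈ T ∨ x ∈ U ∨ x ∈ V) : S.card ≤ T.card + U.card + V.card := by
  have h1 : S ⊆ (T ∪ U) ∪ V := by
    intro x hx
    have := h x hx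
    simp only [Finset.mem_union]
    tauto
  have h2 := Finset.card_le_card h1
  have h3 := Finset.card_union_le (T ∪ U) V
  have h4 := Finset.card_union_le T U
  omega

theorem dd_conj {α : Type*} [DecidableEq α] {n : ℕ} (σ : Equiv.Perm (Fin n))
    (A B : Fin n → Fin n → α) : dd (conj σ A) (conj σ B) = dd A B := by
  unfold dd conj
  apply Finset.card_equiv (Equiv.prodCongr σ σ)
  intro p
  simp

theorem GED_attained {α : Type*} [DecidableEq α] {n : ℕ} (A B : Fin n → Fin n → α) :
    ∃ π : Equiv.Perm (Fin n), dd A (conj π B) = GED A B := by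
  obtain ⟨π, _, h⟩ := Finset.exists_mem_eq_inf' (Finset.univ_nonempty)
    (fun π : Equiv.Perm (Fin n) => dd A (conj π B))
  exact ⟨π, h.symm⟩

/-- Lower bound for the common parts of an optimum and two parents: there exist
permutations `π₁`, `π₂` realizing the GEDs under which the three matrices agree
on at least `n² − GED(Opt,A₁) − GED(A₁,A₂)` entries (hence also on at least
`max` of that quantity and `0` entries, since the agreement count is a natural
number), with the analogous diagonal and off-diagonal bounds. -/
theorem common_parts_lower_bound {α : Type*} [DecidableEq α] {n : ℕ}
    (Opt A₁ A₂ : Fin n → Fin n → α) :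
    ∃ π₁ π₂ : Equiv.Perm (Fin n),
      dd Opt (conj π₁ A₁) = GED Opt A₁ ∧
      dd (conj π₁ A₁) (conj π₂ A₂) = GED A₁ A₂ ∧
      (s₃ Opt (conj π₁ A₁) (conj π₂ A₂) : ℤ) ≥
        (n : ℤ) ^ 2 - GED Opt A₁ - GED A₁ A₂ ∧
      (sv₃ Opt (conj π₁ A₁) (conj π₂ A₂) : ℤ) ≥
        (n : ℤ) - dv Opt (conj π₁ A₁) - dv (conj π₁ A₁) (conj π₂ A₂) ∧
      (se₃ Opt (conj π₁ A₁) (conj π₂ A₂) : ℤ) ≥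
        (n : ℤ) * (n - 1) - de Opt (conj π₁ A₁) - de (conj π₁ A₁) (conj π₂ A₂) := by
  obtain ⟨π, hπ⟩ := GED_attained Opt A₁
  obtain ⟨ρ, hρ⟩ := GED_attained A₁ A₂
  have e : dd (conj π A₁) (conj (π.trans ρ) A₂) = GED A₁ A₂ := by
    rw [← hρ, ← dd_conj π A₁ (conj ρ A₂)]
    rfl
  refine ⟨π, π.trans ρ, hπ, e, ?_, ?_, ?_⟩
  · rw [← hπ, ← e]
    generalize conj π A₁ = B
    generalize conj (π.trans ρ) A₂ = C
    have := card_aux (Finset.univ : Finset (Fin n × Fin n)) _ _ _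
      (fun p _ => (by simp; tauto :
        p ∈ (Finset.univ.filter fun p : Fin n × Fin n =>
          Opt p.1 p.2 = B p.1 p.2 ∧ B p.1 p.2 = C p.1 p.2) ∨
        p ∈ (Finset.univ.filter fun p : Fin n × Fin n => Opt p.1 p.2 ≠ B p.1 p.2) ∨
        p ∈ (Finset.univ.filter fun p : Fin n × Fin n => B p.1 p.2 ≠ C p.1 p.2)))
    have h2 : n * n ≤ s₃ Opt B C + dd Opt B + dd B C := by
      simpa [s₃, dd] using this
    zify at h2
    linarith [sq (n : ℤ)]
  · generalize conj π A₁ = B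
    generalize conj (π.trans ρ) A₂ = C
    have := card_aux (Finset.univ : Finset (Fin n)) _ _ _
      (fun p _ => (by simp; tauto :
        p ∈ (Finset.univ.filter fun i : Fin n => Opt i i = B i i ∧ B i i = C i i) ∨
        p ∈ (Finset.univ.filter fun i : Fin n => Opt i i ≠ B i i) ∨
        p ∈ (Finset.univ.filter fun i : Fin n => B i i ≠ C i i)))
    have h2 : n ≤ sv₃ Opt B C + dv Opt B + dv B C := by
      simpa [sv₃, dv] using this
    zify at h2
    linarith
  · generalize conj π A₁ = B
    generalize conj (π.trans ρ) A₂ = C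
    have h2 : (Finset.univ : Finset (Fin n)).offDiag.card ≤
        se₃ Opt B C + de Opt B + de B C := by
      unfold se₃ de
      apply card_aux
      intro p hp
      simp at hp
      simp
      tauto
    rw [Finset.offDiag_card, Finset.card_univ, Fintype.card_fin] at h2
    have h3 : n * n ≤ se₃ Opt B C + de Opt B + de B C + n := by omega
    zify at h3
    linarith
end
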